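/- In any tournament on n players with n a power of two, every member of the Slater set is an SE winner. -/

import Mathlib

/-- A tournament relation on `V`: irreflexive, asymmetric, and total. -/
structure IsTournament {V : Type*} (beats : V → V → Prop) : Prop where
  irrefl : ∀ v, ¬ beats v v
  asymm : ∀ u v, beats u v → ¬ beats v u
  total : ∀ u v, u ≠ v → beats u v ∨ beats v u

/-- `SEWinner beats S v` : the player `v` can win a balanced single-elimination
tournament among the players of `S` under some seeding.  Either `S = {v}`, or `S`
can be partitioned into pairs (via a fixed-point-free involution `f` of `S`) such
that `v` is an SE winner of the set `W` of winners of the pairs. -/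
inductive SEWinner {V : Type*} (beats : V → V → Prop) : Finset V → V → Prop
  | single (v : V) : SEWinner beats {v} v
  | round (S W : Finset V) (f : V → V) (v : V)
      (hf : ∀ x ∈ S, f x ∈ S ∧ f x ≠ x ∧ f (f x) = x)
      (hW : ∀ x, x ∈ W ↔ x ∈ S ∧ beats x (f x))
      (hw : SEWinner beats W v) : SEWinner beats S v

/-- A king: every other player is beaten by `v` or by someone `v` beats. -/
def IsKing {V : Type*} (beats : V → V → Prop) (v : V) : Prop :=
  ∀ u, u ≠ v → beats v u ∨ ∃ w, beats v w ∧ beats w u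

/-- A 3-king: every other player is reachable from `v` in at most 3 steps. -/
def IsThreeKing {V : Type*} (beats : V → V → Prop) (v : V) : Prop :=
  ∀ u, u ≠ v → beats v u ∨ (∃ w, beats v w ∧ beats w u) ∨
    ∃ w x, beats v w ∧ beats w x ∧ beats x u

/-- The out-degree of a player. -/
noncomputable def outDeg {V : Type*} [Fintype V] (beats : V → V → Prop) (v : V) : ℕ :=
  {u | beats v u}.ncard

/-- The number of directed `k`-paths originating at `v`. -/
noncomputable def kPathCount {V : Type*} [Fintype V] (beats : V → V → Prop) (k : ℕ) (v : V) : ℕ :=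
  {p : Fin (k + 1) → V | Function.Injective p ∧ p 0 = v ∧
    ∀ i : Fin k, beats (p i.castSucc) (p i.succ)}.ncard

/-- A superking: a king `v` such that every player beating `v` is beaten by at
least `log₂ n` players whom `v` beats. -/
def IsSuperking {V : Type*} [Fintype V] (beats : V → V → Prop) (v : V) : Prop :=
  IsKing beats v ∧ ∀ u, beats u v →
    Real.logb 2 (Fintype.card V) ≤ ({w | beats v w ∧ beats w u}.ncard : ℝ)

/-- The number of disagreements between the tournament `beats` and the ranking `σ`
(lower `σ`-value = higher rank): ordered pairs `(u, w)` with `u` beating `w` but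
`w` ranked above `u`. -/
noncomputable def slaterDist {V : Type*} [Fintype V] (beats : V → V → Prop)
    (σ : V ≃ Fin (Fintype.card V)) : ℕ :=
  {q : V × V | beats q.1 q.2 ∧ σ q.2 < σ q.1}.ncard

/-- One round: `S` can be paired up with winner set `W`. -/
inductive PairRound {V : Type*} [DecidableEq V] (beats : V → V → Prop) :
    Finset V → Finset V → Prop
  | nil : PairRound beats ∅ ∅
  | cons (S W : Finset V) (x y : V) (hx : x ∉ S) (hy : y ∉ S) (hb : beats x y)
      (h : PairRound beats S W) : PairRound beats (insert x (insert y S)) (insert x W)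

section
variable {V : Type*} [DecidableEq V] {beats : V → V → Prop}

theorem PairRound.subset {S W : Finset V} (h : PairRound beats S W) : W ⊆ S := by
  induction h with
  | nil => simp
  | cons S W x y hx hy hb h ih =>
    exact Finset.insert_subset_insert _ (ih.trans (Finset.subset_insert _ _))

theorem PairRound.card (hT : IsTournament beats) {S W : Finset V}
    (h : PairRound beats S W) : S.card = 2 * W.card := by
  induction h with
  | nil => simp
  | cons S W x y hx hy hb h ih =>
    have hxy : x ≠ y := fun e => hT.irrefl y (e ▸ hb)
    rw [Finset.card_insert_of_notMem (by simp [hxy, hx]),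
      Finset.card_insert_of_notMem hy,
      Finset.card_insert_of_notMem (fun hh => hx (h.subset hh))]
    omega

theorem PairRound.union {S W S' W' : Finset V} (h : PairRound beats S W)
    (h' : PairRound beats S' W') (hd : Disjoint S S') :
    PairRound beats (S ∪ S') (W ∪ W') := by
  induction h with
  | nil => simpa using h'
  | cons S W x y hx hy hb h ih =>
    simp only [Finset.disjoint_insert_left] at hd
    rw [Finset.insert_union, Finset.insert_union, Finset.insert_union]
    exact PairRound.cons _ _ _ _ (by simp [hx, hd.1]) (by simp [hy, hd.2.1]) hb (ih hd.2.2)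

theorem PairRound.invol (hT : IsTournament beats) {S W : Finset V}
    (h : PairRound beats S W) : ∃ f : V → V,
      (∀ x ∈ S, f x ∈ S ∧ f x ≠ x ∧ f (f x) = x) ∧
      (∀ x, x ∈ W ↔ x ∈ S ∧ beats x (f x)) := by
  induction h with
  | nil => exact ⟨id, by simp, by simp⟩
  | cons S W x y hx hy hb h ih =>
    obtain ⟨f, hf, hW⟩ := ih
    have hxy : x ≠ y := fun e => hT.irrefl y (e ▸ hb)
    have hyx := hT.asymm _ _ hb
    refine ⟨fun z => if z = x then y else if z = y then x else f z, ?_, ?_⟩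
    · intro z hz
      simp only [Finset.mem_insert] at hz ⊢
      rcases hz with rfl | rfl | hz
      · simp [hxy.symm]
      · simp [hxy.symm, hxy]
      · have h1 : z ≠ x := fun e => hx (e ▸ hz)
        have h2 : z ≠ y := fun e => hy (e ▸ hz)
        obtain ⟨h3, h4, h5⟩ := hf z hz
        have h6 : f z ≠ x := fun e => hx (e ▸ h3)
        have h7 : f z ≠ y := fun e => hy (e ▸ h3)
        simp [h1, h2, h3, h4, h5, h6, h7]
    · intro z
      simp only [Finset.mem_insert]
      by_cases h1 : z = x
      · subst h1; simp [hb]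
      by_cases h2 : z = y
      · subst h2
        have : z ∉ W := fun hh => hy (h.subset hh)
        simp [h1, this, hyx]
      simp [h1, h2, hW]

theorem pairRound_even (hT : IsTournament beats) (n : ℕ) :
    ∀ X : Finset V, X.card = 2 * n → ∃ W, PairRound beats X W := by
  induction n with
  | zero =>
    intro X hX
    have : X = ∅ := by simpa using hX
    subst this
    exact ⟨∅, PairRound.nil⟩
  | succ n ih =>
    intro X hX
    obtain ⟨x, y, Y, hx, hy, rfl, hc⟩ : ∃ x y Y, x ∉ insert y Y ∧ y ∉ Y ∧
        insert x (insert y Y) = X ∧ Y.card = 2 * n := by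
      obtain ⟨x, Z, hx, rfl, hZ⟩ := Finset.card_eq_succ.1 (show X.card = (2 * n + 1) + 1 by omega)
      obtain ⟨y, Y, hy, rfl, hY⟩ := Finset.card_eq_succ.1 hZ
      exact ⟨x, y, Y, hx, hy, rfl, hY⟩
    obtain ⟨W, hW⟩ := ih Y hc
    simp only [Finset.mem_insert, not_or] at hx
    rcases hT.total x y hx.1 with h | h
    · exact ⟨_, PairRound.cons _ _ _ _ hx.2 hy h hW⟩
    · rw [Finset.insert_comm]
      exact ⟨_, PairRound.cons _ _ _ _ hy hx.2 h hW⟩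

theorem maximal_matching (n : ℕ) :
    ∀ A B : Finset V, A.card = n → Disjoint A B → ∃ M N : Finset V, M ⊆ A ∧ N ⊆ B ∧
      M.card = N.card ∧ PairRound beats (M ∪ N) M ∧
      (∀ a ∈ A \ M, ∀ b ∈ B \ N, ¬ beats a b) ∧
      ((∃ a ∈ A, ∃ b ∈ B, beats a b) → 1 ≤ M.card) := by
  induction n with
  | zero =>
    intro A B hA _
    have : A = ∅ := by simpa using hA
    subst this
    exact ⟨∅, ∅, by simp, by simp, by simp, by simpa using PairRound.nil, by simp, by simp⟩
  | succ n ih =>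
    intro A B hA hd
    by_cases he : ∃ a ∈ A, ∃ b ∈ B, beats a b
    · obtain ⟨a, ha, b, hb, hab⟩ := he
      obtain ⟨M, N, hM, hN, hc, hR, hmax, -⟩ := ih (A.erase a) (B.erase b)
        (by rw [Finset.card_erase_of_mem ha]; omega)
        (hd.mono (Finset.erase_subset _ _) (Finset.erase_subset _ _))
      have hd' := Finset.disjoint_left.1 hd
      have haM : a ∉ M := fun h => by simpa using hM h
      have hbN : b ∉ N := fun h => by simpa using hN h
      have haN : a ∉ N := fun h => hd' ha (Finset.mem_of_mem_erase (hN h))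
      have hbM : b ∉ M := fun h => hd' (Finset.mem_of_mem_erase (hM h)) hb
      refine ⟨insert a M, insert b N, ?_, ?_, ?_, ?_, ?_, ?_⟩
      · exact Finset.insert_subset ha (hM.trans (Finset.erase_subset _ _))
      · exact Finset.insert_subset hb (hN.trans (Finset.erase_subset _ _))
      · rw [Finset.card_insert_of_notMem haM, Finset.card_insert_of_notMem hbN, hc]
      · rw [Finset.insert_union, Finset.union_insert]
        exact PairRound.cons _ _ _ _ (by simp [haM, haN]) (by simp [hbM, hbN]) hab hR
      · intro x hx y hy
        simp only [Finset.mem_sdiff, Finset.mem_insert, not_or] at hx hy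
        exact hmax x (by simp [hx]) y (by simp [hy])
      · intro _
        rw [Finset.card_insert_of_notMem haM]; omega
    · refine ⟨∅, ∅, by simp, by simp, by simp, by simpa using PairRound.nil, ?_, ?_⟩
      · intro x hx y hy hxy
        exact he ⟨x, by simpa using hx, y, by simpa using hy, hxy⟩
      · exact fun h => absurd h he

theorem rest_pair (hT : IsTournament beats) (A B : Finset V) (hd : Disjoint A B)
    (hev : Even (A.card + B.card)) (hno : ∀ a ∈ A, ∀ b ∈ B, ¬ beats a b) :
    ∃ WA WB, WA ⊆ A ∧ WB ⊆ B ∧ PairRound beats (A ∪ B) (WA ∪ WB) ∧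
      2 * WB.card ≤ B.card + 1 := by
  rcases Nat.even_or_odd A.card with ha | ha
  · have hb : Even B.card := (Nat.even_add.1 hev).1 ha
    obtain ⟨m, hm⟩ := ha
    obtain ⟨l, hl⟩ := hb
    obtain ⟨WA, hA⟩ := pairRound_even hT m A (by omega)
    obtain ⟨WB, hB⟩ := pairRound_even hT l B (by omega)
    exact ⟨WA, WB, hA.subset, hB.subset, hA.union hB hd, by have := hB.card hT; omega⟩
  · have hb : Odd B.card := by
      rw [← Nat.not_even_iff_odd] at ha ⊢
      intro hb; exact ha ((Nat.even_add.1 hev).2 hb)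
    obtain ⟨m, hm⟩ := ha
    obtain ⟨l, hl⟩ := hb
    obtain ⟨a, A', haA, rfl, hA'⟩ := Finset.card_eq_succ.1 hm
    obtain ⟨b, B', hbB, rfl, hB'⟩ := Finset.card_eq_succ.1 hl
    obtain ⟨WA, hA⟩ := pairRound_even hT m A' (by omega)
    obtain ⟨WB, hB⟩ := pairRound_even hT l B' (by omega)
    have hd' := Finset.disjoint_left.1 hd
    have hab : a ≠ b := by
      rintro rfl
      exact hd' (Finset.mem_insert_self _ _) (Finset.mem_insert_self _ _)
    have hba : beats b a := (hT.total a b hab).resolve_left (hno _ (by simp) _ (by simp))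
    have haB : a ∉ B' := fun h => hd' (Finset.mem_insert_self _ _) (by simp [h])
    have hbA : b ∉ A' := fun h => hd' (Finset.mem_insert_of_mem h) (by simp)
    refine ⟨WA, insert b WB, hA.subset.trans (Finset.subset_insert _ _),
      Finset.insert_subset_insert _ hB.subset, ?_, ?_⟩
    · rw [Finset.union_insert, Finset.insert_union, Finset.union_insert]
      exact PairRound.cons _ _ _ _ (by simp [hbA, hbB]) (by simp [haA, haB]) hba
        (hA.union hB (hd.mono (Finset.subset_insert _ _) (Finset.subset_insert _ _)))
    · have := hB.card hT
      have := Finset.card_insert_le b WB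
      omega

set_option maxHeartbeats 1000000 in
open Classical in
theorem king_SE (hT : IsTournament beats) (v : V) (k : ℕ) :
    ∀ S : Finset V, v ∈ S → S.card = 2 ^ k →
      2 * (S.filter (fun x => beats x v)).card < 2 ^ k →
      (∀ u ∈ S, beats u v → ∃ w ∈ S, beats v w ∧ beats w u) →
      SEWinner beats S v := by
  induction k with
  | zero =>
    intro S hv hS _ _
    obtain ⟨x, rfl⟩ := Finset.card_eq_one.1 (by simpa using hS)
    rw [Finset.mem_singleton] at hv
    subst hv
    exact SEWinner.single v
  | succ k ih =>
    intro S hv hS hB hking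
    set B := S.filter (fun x => beats x v) with hBdef
    set A := S.filter (fun x => beats v x) with hAdef
    have hAB : Disjoint A B := by
      rw [Finset.disjoint_left]
      intro x hx hx'
      simp only [hAdef, hBdef, Finset.mem_filter] at hx hx'
      exact hT.asymm _ _ hx.2 hx'.2
    have hvA : v ∉ A := by simp [hAdef, hT.irrefl]
    have hvB : v ∉ B := by simp [hBdef, hT.irrefl]
    have hSeq : S = insert v (A ∪ B) := by
      ext x
      simp only [hAdef, hBdef, Finset.mem_insert, Finset.mem_union, Finset.mem_filter]
      constructor
      · intro hx
        by_cases h : x = v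
        · exact Or.inl h
        · rcases hT.total x v h with h | h <;> tauto
      · rintro (rfl | h | h)
        · exact hv
        · exact h.1
        · exact h.1
    have hcard : A.card + B.card + 1 = 2 ^ (k + 1) := by
      rw [← hS, hSeq, Finset.card_insert_of_notMem (by simp [hvA, hvB]),
        Finset.card_union_of_disjoint hAB]
    rw [pow_succ] at hcard hB
    obtain ⟨M, N, hM, hN, hMN, hR, hmax, hpos⟩ :=
      maximal_matching (beats := beats) A.card A B rfl hAB
    have hNB := Finset.card_le_card hN
    obtain ⟨a0, ha0, ha0M⟩ : ∃ a ∈ A, a ∉ M := by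
      by_contra! hcon
      have := Finset.card_le_card (show A ⊆ M from hcon)
      omega
    have hva0 : beats v a0 := (Finset.mem_filter.1 ha0).2
    have hcA : ((A \ M).erase a0).card + M.card + 1 = A.card := by
      rw [Finset.card_erase_of_mem (by simp [ha0, ha0M]), Finset.card_sdiff_of_subset hM]
      have h1 : 0 < (A \ M).card := Finset.card_pos.2 ⟨a0, by simp [ha0, ha0M]⟩
      rw [Finset.card_sdiff_of_subset hM] at h1
      omega
    have hcB : (B \ N).card + N.card = B.card := by
      rw [Finset.card_sdiff_of_subset hN]; omega
    obtain ⟨WA, WB, hWA, hWB, hR2, hc2⟩ := rest_pair hT ((A \ M).erase a0) (B \ N)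
      (hAB.mono ((Finset.erase_subset _ _).trans Finset.sdiff_subset) Finset.sdiff_subset)
      (by
        refine ⟨2 ^ k - 1 - M.card, ?_⟩
        omega)
      (fun a ha b hb => hmax a (Finset.mem_of_mem_erase ha) b hb)
    have hdl := Finset.disjoint_left.1 hAB
    have hdis : Disjoint (M ∪ N) ((A \ M).erase a0 ∪ B \ N) := by
      rw [Finset.disjoint_left]
      intro x hx hx'
      simp only [Finset.mem_union, Finset.mem_erase, Finset.mem_sdiff] at hx hx'
      have h1 := @hM x
      have h2 := @hN x
      have h3 := @hdl x
      tauto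
    have hR3 := hR.union hR2 hdis
    have ha0B : a0 ∉ B := hdl ha0
    have hR4 := PairRound.cons _ _ v a0 (by
        intro hx
        simp only [Finset.mem_union, Finset.mem_erase, Finset.mem_sdiff] at hx
        have h1 := @hM v
        have h2 := @hN v
        tauto) (by
        intro hx
        simp only [Finset.mem_union, Finset.mem_erase, Finset.mem_sdiff] at hx
        have h2 := @hN a0
        tauto) hva0 hR3
    have hS2 : insert v (insert a0 (M ∪ N ∪ ((A \ M).erase a0 ∪ B \ N))) = S := by
      rw [hSeq]
      ext x
      simp only [Finset.mem_insert, Finset.mem_union, Finset.mem_erase, Finset.mem_sdiff]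
      have h1 := @hM x
      have h2 := @hN x
      by_cases hx : x = a0
      · simp [hx, ha0]
      · by_cases h3 : x ∈ M
        · simp [h3, h1 h3]
        · by_cases h4 : x ∈ N
          · simp [h4, h2 h4]
          · simp [hx, h3, h4]
    rw [hS2] at hR4
    obtain ⟨f, hf, hW⟩ := hR4.invol hT
    refine SEWinner.round _ _ f v hf hW (ih _ (by simp) ?_ ?_ ?_)
    · have := hR4.card hT
      rw [hS, pow_succ] at this
      omega
    · have hsub : (insert v (M ∪ (WA ∪ WB))).filter (fun x => beats x v) ⊆ WB := by
        intro x hx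
        simp only [Finset.mem_filter, Finset.mem_insert, Finset.mem_union] at hx
        obtain ⟨hx, hxv⟩ := hx
        have hxA : x ∉ A := fun h => hT.asymm _ _ hxv (Finset.mem_filter.1 h).2
        have h1 := @hM x
        have h2 := @hWA x
        simp only [Finset.mem_erase, Finset.mem_sdiff] at h2
        have h3 : x ≠ v := fun e => hT.irrefl v (by rwa [e] at hxv)
        tauto
      have h1 := Finset.card_le_card hsub
      have h2 := Finset.card_le_card hWB
      have h3 : 0 < 2 ^ k := by positivity
      rcases B.eq_empty_or_nonempty with h0 | ⟨b, hb⟩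
      · have : B.card = 0 := by simp [h0]
        omega
      · have hb' := Finset.mem_filter.1 hb
        obtain ⟨w, hw, hvw, hwb⟩ := hking b hb'.1 hb'.2
        have := hpos ⟨w, Finset.mem_filter.2 ⟨hw, hvw⟩, b, hb, hwb⟩
        omega
    · intro u hu huv
      have huA : u ∉ A := fun h => hT.asymm _ _ huv (Finset.mem_filter.1 h).2
      have huW : u ∈ WB := by
        simp only [Finset.mem_insert, Finset.mem_union] at hu
        have h1 := @hM u
        have h2 := @hWA u
        simp only [Finset.mem_erase, Finset.mem_sdiff] at h2
        have h3 : u ≠ v := fun e => hT.irrefl v (by rwa [e] at huv)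
        tauto
      have huB := hWB huW
      obtain ⟨w, hw, hvw, hwu⟩ :=
        hking u (Finset.mem_filter.1 (Finset.mem_sdiff.1 huB).1).1 huv
      have hwA : w ∈ A := Finset.mem_filter.2 ⟨hw, hvw⟩
      have hwM : w ∈ M := by
        by_contra hcon
        exact hmax w (by simp [hwA, hcon]) u huB hwu
      exact ⟨w, by simp [hwM], hvw, hwu⟩

end

theorem exists_rank {V : Type*} [Fintype V] (r : V → ℕ) (hr : Function.Injective r) :
    ∃ τ : V ≃ Fin (Fintype.card V), ∀ x y, τ x < τ y ↔ r x < r y := by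
  let _ : LinearOrder V := LinearOrder.lift' r hr
  let e := Fintype.orderIsoFinOfCardEq V rfl
  exact ⟨e.symm.toEquiv, fun x y => e.symm.lt_iff_lt⟩

theorem slater_half {V : Type*} [Fintype V]
    (beats : V → V → Prop) (hT : IsTournament beats)
    (v : V) (σ : V ≃ Fin (Fintype.card V))
    (hopt : ∀ τ : V ≃ Fin (Fintype.card V), slaterDist beats σ ≤ slaterDist beats τ)
    (hfirst : (σ v : ℕ) = 0) : {x | beats x v}.ncard ≤ {x | beats v x}.ncard := by
  classical
  obtain ⟨τ, hτ⟩ := exists_rank (fun x => if x = v then Fintype.card V else (σ x : ℕ)) (by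
    intro x y h
    have h1 := (σ x).2
    have h2 := (σ y).2
    by_cases hx : x = v <;> by_cases hy : y = v <;> simp only [hx, hy, if_true, if_false] at h ⊢
    · omega
    · omega
    · exact σ.injective (Fin.ext h))
  have h := hopt τ
  set C : Set (V × V) := {q | beats q.1 q.2 ∧ σ q.2 < σ q.1 ∧ q.1 ≠ v ∧ q.2 ≠ v} with hC
  have e1 : {q : V × V | beats q.1 q.2 ∧ σ q.2 < σ q.1} =
      C ∪ (fun x => (x, v)) '' {x | beats x v} := by
    ext ⟨x, y⟩
    simp only [hC, Set.mem_ofPred_eq, Set.mem_union, Set.mem_image, Prod.mk.injEq]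
    constructor
    · rintro ⟨h1, h2⟩
      have hx : x ≠ v := by
        rintro rfl
        rw [Fin.lt_def] at h2; omega
      by_cases hy : y = v
      · subst hy; exact Or.inr ⟨x, h1, rfl, rfl⟩
      · exact Or.inl ⟨h1, h2, hx, hy⟩
    · rintro (h | ⟨z, hz, rfl, rfl⟩)
      · exact ⟨h.1, h.2.1⟩
      · refine ⟨hz, ?_⟩
        have : z ≠ v := fun e => hT.irrefl v (by rwa [e] at hz)
        rw [Fin.lt_def, hfirst]
        by_contra hcon
        exact this (σ.injective (Fin.ext (by omega)))
  have e2 : {q : V × V | beats q.1 q.2 ∧ τ q.2 < τ q.1} ⊆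
      C ∪ (fun x => (v, x)) '' {x | beats v x} := by
    rintro ⟨x, y⟩ ⟨h1, h2⟩
    simp only [hC, Set.mem_ofPred_eq, Set.mem_union, Set.mem_image, Prod.mk.injEq]
    dsimp only at h1 h2
    rw [hτ] at h2
    by_cases hx : x = v
    · subst hx; exact Or.inr ⟨y, h1, rfl, rfl⟩
    · by_cases hy : y = v
      · have := (σ x).2
        simp only [hx, hy, if_true, if_false] at h2
        omega
      · simp only [hx, hy, if_false] at h2
        exact Or.inl ⟨h1, Fin.lt_def.2 h2, hx, hy⟩
  unfold slaterDist at h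
  have h2 := (Set.ncard_le_ncard e2 (Set.toFinite _)).trans (Set.ncard_union_le _ _)
  rw [e1, Set.ncard_union_eq (by
      rw [Set.disjoint_left]
      rintro ⟨x, y⟩ hq ⟨z, _, hz⟩
      simp only [Prod.mk.injEq] at hz
      exact hq.2.2.2 hz.2.symm) (Set.toFinite _) (Set.toFinite _),
    Set.ncard_image_of_injective _ (fun a b hab => (Prod.mk.inj hab).1)] at h
  rw [Set.ncard_image_of_injective _ (fun a b hab => (Prod.mk.inj hab).2)] at h2
  omega

theorem slater_king {V : Type*} [Fintype V]
    (beats : V → V → Prop) (hT : IsTournament beats)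
    (v : V) (σ : V ≃ Fin (Fintype.card V))
    (hopt : ∀ τ : V ≃ Fin (Fintype.card V), slaterDist beats σ ≤ slaterDist beats τ)
    (hfirst : (σ v : ℕ) = 0) (u : V) (huv : beats u v) :
    ∃ w, beats v w ∧ beats w u := by
  classical
  by_contra! hcon
  have hne : u ≠ v := fun e => hT.irrefl v (by rwa [e] at huv)
  have hmin : ∀ x, x ≠ v → σ v < σ x := by
    intro x hx
    rw [Fin.lt_def, hfirst]
    by_contra hc
    exact hx (σ.injective (Fin.ext (by omega)))
  have hmin' : ∀ x, ¬ σ x < σ v := by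
    intro x hx
    rw [Fin.lt_def] at hx; omega
  have hc1 : ∀ w, beats v w → beats u w := by
    intro w hw
    refine (hT.total u w ?_).resolve_right (hcon w hw)
    rintro rfl
    exact hT.asymm _ _ huv hw
  have hc2 : ∀ w, beats w u → beats w v := by
    intro w hw
    refine (hT.total w v ?_).resolve_right (fun h => hcon w h hw)
    rintro rfl
    exact hT.asymm _ _ huv hw
  set s := Equiv.swap u v with hs
  have hsu : s u = v := Equiv.swap_apply_left _ _
  have hsv : s v = u := Equiv.swap_apply_right _ _
  have hso : ∀ w, w ≠ u → w ≠ v → s w = w := fun w => Equiv.swap_apply_of_ne_of_ne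
  have hss : ∀ w, s (s w) = w := fun w => Equiv.swap_apply_self _ _ _
  have h := hopt (s.trans σ)
  unfold slaterDist at h
  simp only [Equiv.trans_apply] at h
  set D : Set (V × V) := {q | beats q.1 q.2 ∧ σ q.2 < σ q.1} with hD
  set E : Set (V × V) := {q | beats q.1 q.2 ∧ σ (s q.2) < σ (s q.1)} with hE
  have huvD : (u, v) ∈ D := ⟨huv, hmin u hne⟩
  have huvE : (u, v) ∉ E := fun hh => by
    have := hh.2
    simp only [hsu, hsv] at this
    exact hmin' _ this
  have key : ∀ q ∈ E, q ∉ D → (s q.1, s q.2) ∈ D ∧ (s q.1, s q.2) ≠ (u, v) := by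
    rintro ⟨x, y⟩ ⟨h1, h2⟩ hnD
    dsimp only at h1 h2
    have hn : ¬ σ y < σ x := fun hh => hnD ⟨h1, hh⟩
    refine ⟨⟨?_, h2⟩, ?_⟩
    · dsimp only
      by_cases hxu : x = u
      · subst hxu
        rw [hsu] at h2
        exact absurd h2 (hmin' _)
      by_cases hyv : y = v
      · subst hyv
        by_cases hxv : x = y
        · subst hxv; exact absurd h1 (hT.irrefl _)
        · exact absurd (hmin x hxv) hn
      by_cases hxv : x = v
      · subst hxv
        by_cases hyu : y = u
        · subst hyu; exact absurd h1 (hT.asymm _ _ huv)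
        · rw [hsv, hso y hyu hyv]; exact hc1 _ h1
      · rw [hso x hxu hxv]
        by_cases hyu : y = u
        · subst hyu; rw [hsu]; exact hc2 _ h1
        · rw [hso y hyu hyv]; exact h1
    · intro he
      obtain ⟨h3, h4⟩ := Prod.mk.inj he
      have hx : x = v := by rw [← hss x]; dsimp only at h3; rw [h3, hsu]
      have hy : y = u := by rw [← hss y]; dsimp only at h4; rw [h4, hsv]
      subst hx hy
      exact hT.asymm _ _ huv h1
  have hle : E.ncard ≤ (D \ {(u, v)}).ncard := by
    refine Set.ncard_le_ncard_of_injOn (fun q => if q ∈ D then q else (s q.1, s q.2)) ?_ ?_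
      (Set.toFinite _)
    · intro q hq
      by_cases hqD : q ∈ D
      · simp only [hqD, if_true]
        exact ⟨hqD, fun e => huvE (by rwa [← Set.mem_singleton_iff.1 e])⟩
      · simp only [hqD, if_false]
        exact ⟨(key q hq hqD).1, (key q hq hqD).2⟩
    · intro q hq q' hq' he
      by_cases hqD : q ∈ D <;> by_cases hqD' : q' ∈ D <;>
        simp only [hqD, hqD', if_true, if_false] at he
      · exact he
      · exfalso
        rw [he] at hq
        have := hq.2
        simp only [hss] at this
        exact hqD' ⟨hq'.1, this⟩
      · exfalso
        rw [← he] at hq'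
        have := hq'.2
        simp only [hss] at this
        exact hqD ⟨hq.1, this⟩
      · obtain ⟨h3, h4⟩ := Prod.mk.inj he
        exact Prod.ext (s.injective h3) (s.injective h4)
  have := Set.ncard_sdiff_singleton_lt_of_mem huvD (Set.toFinite _)
  omega

/-- every member of the Slater set is an SE winner. -/
theorem slater_SE_winner {V : Type*} [Fintype V]
    (beats : V → V → Prop) (hT : IsTournament beats)
    (k : ℕ) (hcard : Fintype.card V = 2 ^ k)
    (v : V) (σ : V ≃ Fin (Fintype.card V))
    (hopt : ∀ τ : V ≃ Fin (Fintype.card V), slaterDist beats σ ≤ slaterDist beats τ)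
    (hfirst : (σ v : ℕ) = 0) :
    SEWinner beats Finset.univ v := by
  classical
  refine king_SE hT v k Finset.univ (Finset.mem_univ _) (by simpa using hcard) ?_ ?_
  · have h := slater_half beats hT v σ hopt hfirst
    rw [Set.ncard_eq_toFinset_card', Set.ncard_eq_toFinset_card', Set.toFinset_ofPred,
      Set.toFinset_ofPred] at h
    have hd : Disjoint (Finset.univ.filter (fun x => beats x v))
        (Finset.univ.filter (fun x => beats v x)) := by
      rw [Finset.disjoint_left]
      intro x hx hx'
      exact hT.asymm _ _ (Finset.mem_filter.1 hx).2 (Finset.mem_filter.1 hx').2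
    have hlt : ((Finset.univ.filter (fun x => beats x v)) ∪
        (Finset.univ.filter (fun x => beats v x))).card < Fintype.card V := by
      refine Finset.card_lt_univ_of_notMem (x := v) ?_
      simp [hT.irrefl]
    rw [Finset.card_union_of_disjoint hd, hcard] at hlt
    have : (Finset.univ.filter (fun x => beats x v)).card ≤
        (Finset.univ.filter (fun x => beats v x)).card := by
      convert h
    have h2 : 2 * (Finset.univ.filter (fun x => beats x v)).card < 2 ^ k := by omega
    convert h2
  · intro u _ hu
    obtain ⟨w, h1, h2⟩ := slater_king beats hT v σ hopt hfirst u hu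
    exact ⟨w, Finset.mem_univ _, h1, h2⟩
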